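/- Let α ∈ ℝ with α ≠ 0, c₁, c₂ ∈ ℝ with c₁² + c₂² > 0, c₃ > 0, and c₇, c₈, c₉, c₁₀ ∈ ℝ. Define z₁(τ) = τ/(2α³c₃) - (c₁c₇ + c₂c₈)/(α(c₁² + c₂²)) + c₉ tanh(τ) + c₁₀ (1 - τ tanh(τ)) for τ ∈ ℝ. Then for all τ ∈ ℝ: cosh²(τ) · z₁''(τ) + 2 z₁(τ) = τ/(α³c₃) - 2(c₁c₇ + c₂c₈)/(α(c₁² + c₂²)). -/

import Mathlib

theorem hasDerivAt_tanh_aux (x : ℝ) : HasDerivAt Real.tanh (1 - Real.tanh x ^ 2) x := by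
  have hc : Real.cosh x ≠ 0 := (Real.cosh_pos x).ne'
  have h := (Real.hasDerivAt_sinh x).div (Real.hasDerivAt_cosh x) hc
  have e : Real.tanh = Real.sinh / Real.cosh := by
    funext y
    simp [Real.tanh_eq_sinh_div_cosh]
  rw [← e] at h
  refine h.congr_deriv ?_
  rw [Real.tanh_eq_sinh_div_cosh]
  field_simp

theorem K3_magnetic_z1_ode_solution (α c₁ c₂ c₃ c₇ c₈ c₉ c₁₀ : ℝ)
    (hα : α ≠ 0) (hc : c₁ ^ 2 + c₂ ^ 2 > 0) (hc₃ : c₃ > 0)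
    (z₁ : ℝ → ℝ)
    (hz₁ : ∀ τ : ℝ, z₁ τ = τ / (2 * α ^ 3 * c₃) -
      (c₁ * c₇ + c₂ * c₈) / (α * (c₁ ^ 2 + c₂ ^ 2)) +
      c₉ * Real.tanh τ + c₁₀ * (1 - τ * Real.tanh τ)) :
    ∀ τ : ℝ, Real.cosh τ ^ 2 * deriv (deriv z₁) τ + 2 * z₁ τ =
      τ / (α ^ 3 * c₃) - 2 * (c₁ * c₇ + c₂ * c₈) / (α * (c₁ ^ 2 + c₂ ^ 2)) := by
  intro τ
  have hz : z₁ = fun τ : ℝ => τ / (2 * α ^ 3 * c₃) -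
      (c₁ * c₇ + c₂ * c₈) / (α * (c₁ ^ 2 + c₂ ^ 2)) +
      c₉ * Real.tanh τ + c₁₀ * (1 - τ * Real.tanh τ) := funext hz₁
  have h1 : deriv z₁ = fun τ : ℝ => 1 / (2 * α ^ 3 * c₃) + c₉ * (1 - Real.tanh τ ^ 2) +
      c₁₀ * (-(Real.tanh τ + τ * (1 - Real.tanh τ ^ 2))) := by
    funext x
    have hT := hasDerivAt_tanh_aux x
    have h := ((((hasDerivAt_id' x).div_const (2 * α ^ 3 * c₃)).sub_const
      ((c₁ * c₇ + c₂ * c₈) / (α * (c₁ ^ 2 + c₂ ^ 2)))).add (hT.const_mul c₉)).add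
      ((((hasDerivAt_id' x).mul hT).const_sub 1).const_mul c₁₀)
    rw [hz]
    refine (h.congr_deriv ?_).deriv
    ring
  have h2 : deriv (deriv z₁) τ = (1 - Real.tanh τ ^ 2) *
      (-2 * c₉ * Real.tanh τ + c₁₀ * (-2 + 2 * τ * Real.tanh τ)) := by
    have hT := hasDerivAt_tanh_aux τ
    have hS := (hT.pow 2).const_sub 1
    have h := ((hS.const_mul c₉).const_add (1 / (2 * α ^ 3 * c₃))).add
      (((hT.add ((hasDerivAt_id' τ).mul hS)).neg).const_mul c₁₀)
    rw [h1]
    refine (h.congr_deriv ?_).deriv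
    simp
    ring
  have h3 : Real.cosh τ ^ 2 * (1 - Real.tanh τ ^ 2) = 1 := by
    have hc : Real.cosh τ ≠ 0 := (Real.cosh_pos τ).ne'
    rw [Real.tanh_eq_sinh_div_cosh]
    field_simp
    linarith [Real.cosh_sq τ]
  rw [h2, ← mul_assoc, h3, hz₁]
  have h4 : τ / (α ^ 3 * c₃) = 2 * (τ / (2 * α ^ 3 * c₃)) := by
    field_simp
  rw [h4]
  ring
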